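/- For all integers n ≥ 1 and r with 0 ≤ r ≤ (n−1)/2, the cardinality of the ℓ∞-ball of radius r in S_n satisfies |B_{r,n}| ≤ ((2r+1)!)^((n−2r)/(2r+1)) · ∏_{i=r+1}^{2r} (i!)^(2/i), where the right-hand side is interpreted as a real number with real exponents. -/

import Mathlib

/-- The ℓ∞-distance between two permutations of `Fin n`:
`d∞(f,g) = max_i |f(i) - g(i)|`. -/
def dinf {n : ℕ} (f g : Equiv.Perm (Fin n)) : ℕ :=
  Finset.univ.sup fun i => (((f i : ℕ) : ℤ) - ((g i : ℕ) : ℤ)).natAbs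

/-- The cardinality of a ball of radius `r` in `S_n` under the ℓ∞-metric
(the metric is right-invariant, so the size does not depend on the center;
we take the identity as the center). -/
noncomputable def ballCard (n r : ℕ) : ℕ :=
  Nat.card {g : Equiv.Perm (Fin n) | dinf g 1 ≤ r}

open Finset in
/-- `φ m = log (m!) / m`, with `φ 0 = 0`. -/
noncomputable def bregPhi (m : ℕ) : ℝ := Real.log (m.factorial : ℝ) / m

lemma bregPhi_nonneg (m : ℕ) : 0 ≤ bregPhi m := by
  unfold bregPhi
  have : (1 : ℝ) ≤ (m.factorial : ℝ) := by exact_mod_cast m.factorial_pos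
  exact div_nonneg (Real.log_nonneg this) (Nat.cast_nonneg _)

lemma mul_bregPhi (m : ℕ) : (m : ℝ) * bregPhi m = Real.log (m.factorial : ℝ) := by
  unfold bregPhi
  rcases Nat.eq_zero_or_pos m with h | h
  · subst h; simp
  · field_simp

lemma breg_xlog (x a : ℝ) (hx : 0 ≤ x) (ha : 0 < a) :
    x * Real.log a + x - a ≤ x * Real.log x := by
  rcases hx.eq_or_lt with h | h
  · subst h; simp; exact ha.le
  · have h1 := Real.log_le_sub_one_of_pos (div_pos ha h)
    rw [Real.log_div ha.ne' h.ne'] at h1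
    have h2 := mul_le_mul_of_nonneg_left h1 hx
    have h3 : x * (a / x - 1) = a - x := by field_simp
    rw [h3] at h2
    linarith

/-- log-sum inequality -/
lemma breg_jensen {κ : Type} (s : Finset κ) (p : κ → ℝ) (hp : ∀ k, 0 ≤ p k) (P : ℝ) (hP : 0 < P)
    (hs : 0 < s.card) (hsum : ∑ k ∈ s, p k = P) :
    P * Real.log P ≤ P * Real.log s.card + ∑ k ∈ s, p k * Real.log (p k) := by
  have hc : (0 : ℝ) < s.card := by exact_mod_cast hs
  have h := Finset.sum_le_sum (fun k (_ : k ∈ s) => breg_xlog (p k) (P / s.card) (hp k) (div_pos hP hc))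
  rw [Finset.sum_sub_distrib, Finset.sum_add_distrib, ← Finset.sum_mul, hsum, Finset.sum_const,
    Real.log_div hP.ne' hc.ne', nsmul_eq_mul] at h
  have : (s.card : ℝ) * (P / s.card) = P := by field_simp
  rw [this] at h
  linarith

open Finset in
/-- the number of bijections compatible with `F` -/
noncomputable def bregS {α β : Type} [Fintype α] [Fintype β] [DecidableEq α] [DecidableEq β]
    (F : α → Finset β) : Finset (α ≃ β) := univ.filter fun σ => ∀ i, σ i ∈ F i

open Finset in
lemma breg_minor {α β : Type} [Fintype α] [Fintype β] [DecidableEq α] [DecidableEq β]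
    (F : α → Finset β) (i : α) (k : β) :
    ((bregS F).filter fun σ => σ i = k).card ≤
      (bregS (fun j : {j : α // j ≠ i} => (F j).subtype (fun y => y ≠ k))).card := by
  classical
  rw [← Finset.card_attach]
  have hk : ∀ σ : {σ // σ ∈ (bregS F).filter fun σ => σ i = k}, σ.1 i = k :=
    fun σ => (Finset.mem_filter.mp σ.2).2
  refine Finset.card_le_card_of_injOn
    (fun σ => σ.1.subtypeEquiv (p := fun j => j ≠ i) (q := fun y => y ≠ k)
      (fun a => not_congr (by
        constructor
        · rintro rfl; exact hk σ
        · intro h; exact σ.1.injective (h.trans (hk σ).symm)))) ?_ ?_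
  · intro σ _
    have h1 := (Finset.mem_filter.mp σ.2).1
    simp only [bregS, Finset.mem_filter, Finset.mem_univ, true_and] at h1
    simp only [bregS, Finset.coe_filter, Finset.mem_univ, true_and, Set.mem_ofPred_eq,
      Finset.mem_subtype]
    intro j
    exact h1 j
  · intro σ _ τ _ h
    apply Subtype.ext
    ext x
    by_cases hx : x = i
    · rw [hx, hk σ, hk τ]
    · have := congrArg (fun e => (e ⟨x, hx⟩).1) h
      exact this

open Finset in
lemma breg_count {α β : Type} [Fintype α] [Fintype β] [DecidableEq α] [DecidableEq β]
    (F : α → Finset β) (σ : α ≃ β) (hσ : ∀ i, σ i ∈ F i) (j : α) :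
    Real.log (F j).card + ∑ i ∈ univ.erase j, bregPhi ((F j).erase (σ i)).card
      = Fintype.card α * bregPhi (F j).card := by
  have h0 : ∑ i ∈ univ.erase j, bregPhi ((F j).erase (σ i)).card
      = ∑ k ∈ univ.erase (σ j), bregPhi ((F j).erase k).card := by
    refine Finset.sum_equiv σ ?_ ?_
    · intro i; simp
    · intro i _; rfl
  rw [h0]
  have hm : σ j ∈ F j := hσ j
  have h1 : (univ.erase (σ j) : Finset β) = ((F j).erase (σ j)) ∪ (F j)ᶜ := by
    ext k; by_cases hk : k ∈ F j <;> simp [hk]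
    rintro rfl; exact hk hm
  have hd : Disjoint ((F j).erase (σ j)) (F j)ᶜ := by
    rw [Finset.disjoint_left]; intro k hk; simp at hk ⊢; exact hk.2
  rw [h1, Finset.sum_union hd]
  have h2 : ∑ k ∈ (F j).erase (σ j), bregPhi ((F j).erase k).card
      = Real.log (((F j).card - 1).factorial : ℝ) := by
    rw [← mul_bregPhi, Finset.sum_congr rfl (g := fun _ => bregPhi ((F j).card - 1))]
    · rw [Finset.sum_const, nsmul_eq_mul, Finset.card_erase_of_mem hm]
    · intro k hk
      rw [Finset.card_erase_of_mem (Finset.mem_of_mem_erase hk)]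
  have h3 : ∑ k ∈ (F j)ᶜ, bregPhi ((F j).erase k).card
      = (Fintype.card α - (F j).card : ℝ) * bregPhi (F j).card := by
    rw [Finset.sum_congr rfl (g := fun _ => bregPhi ((F j).card))]
    · rw [Finset.sum_const, nsmul_eq_mul, Finset.card_compl, Nat.cast_sub (Finset.card_le_univ _),
        Fintype.card_congr σ]
    · intro k hk
      rw [Finset.erase_eq_of_notMem (by simpa using hk)]
  rw [h2, h3]
  have hpos : 0 < (F j).card := Finset.card_pos.mpr ⟨_, hm⟩
  have h4 : Real.log (F j).card + Real.log (((F j).card - 1).factorial : ℝ)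
      = Real.log ((F j).card.factorial : ℝ) := by
    rw [← Real.log_mul (by positivity) (by positivity)]
    congr 1
    exact_mod_cast Nat.mul_factorial_pred hpos.ne'
  have h5 := mul_bregPhi (F j).card
  linarith

open Finset in
/-- Bregman's theorem (Schrijver's proof). -/
theorem bregman (n : ℕ) : ∀ {α β : Type} [Fintype α] [Fintype β] [DecidableEq α] [DecidableEq β]
    (F : α → Finset β), Fintype.card α = n →
    Real.log (bregS F).card ≤ ∑ j, bregPhi (F j).card := by
  induction n with
  | zero =>
    intro α β _ _ _ _ F h
    have : IsEmpty α := Fintype.card_eq_zero_iff.mp h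
    have h1 : (bregS F).card ≤ 1 := by
      rw [Finset.card_le_one]
      intro a _ b _
      ext x; exact isEmptyElim x
    simp only [Finset.univ_eq_empty, Finset.sum_empty]
    exact Real.log_nonpos (by positivity) (by exact_mod_cast h1)
  | succ n ih =>
    intro α β _ _ _ _ F h
    rcases Nat.eq_zero_or_pos (bregS F).card with h0 | hpos
    · rw [h0]; simp; exact Finset.sum_nonneg fun _ _ => bregPhi_nonneg _
    set S := bregS F with hS
    have hmem : ∀ σ ∈ S, ∀ i, σ i ∈ F i := by
      intro σ hσ; simpa [hS, bregS] using hσ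
    obtain ⟨σ₀, hσ₀⟩ := Finset.card_pos.mp hpos
    have hP : (0 : ℝ) < S.card := by exact_mod_cast hpos
    let p : α → β → ℕ := fun i k => (S.filter fun σ => σ i = k).card
    have key : ∀ i k, Real.log (p i k) ≤ ∑ j ∈ univ.erase i, bregPhi ((F j).erase k).card := by
      intro i k
      have hc : Fintype.card {j : α // j ≠ i} = n := by
        rw [Fintype.card_subtype_compl, h]; simp
      have h1 := ih (fun j : {j : α // j ≠ i} => (F j).subtype (fun y => y ≠ k)) hc
      have h2 := breg_minor F i k
      have h3 : ∑ j : {j : α // j ≠ i}, bregPhi ((F j).subtype (fun y => y ≠ k)).card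
          = ∑ j ∈ univ.erase i, bregPhi ((F j).erase k).card := by
        rw [← Finset.sum_subtype (univ.erase i) (p := fun j => j ≠ i) (by simp)
          (fun j => bregPhi ((F j).subtype (fun y => y ≠ k)).card)]
        refine Finset.sum_congr rfl fun j _ => ?_
        rw [Finset.card_subtype, Finset.filter_ne']
      rw [h3] at h1
      refine le_trans ?_ h1
      rcases Nat.eq_zero_or_pos (p i k) with h0 | h0
      · rw [h0]; simp; exact Real.log_natCast_nonneg _
      · exact Real.log_le_log (by exact_mod_cast h0) (by exact_mod_cast h2)
    have step : ∀ i, S.card * Real.log S.card ≤ ∑ σ ∈ S,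
        (Real.log (F i).card + ∑ j ∈ univ.erase i, bregPhi ((F j).erase (σ i)).card) := by
      intro i
      have hmaps : ∀ σ ∈ S, σ i ∈ F i := fun σ hσ => hmem σ hσ i
      have hsum : ∑ k ∈ F i, (p i k : ℝ) = S.card := by
        exact_mod_cast (Finset.card_eq_sum_card_fiberwise hmaps).symm
      have hj := breg_jensen (F i) (fun k => (p i k : ℝ)) (fun k => by positivity) S.card hP
        (Finset.card_pos.mpr ⟨_, hmaps σ₀ hσ₀⟩) hsum
      refine hj.trans ?_
      rw [Finset.sum_add_distrib, Finset.sum_const, nsmul_eq_mul]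
      gcongr
      rw [← Finset.sum_fiberwise_of_maps_to hmaps]
      refine Finset.sum_le_sum fun k _ => ?_
      rw [Finset.sum_congr rfl
        (g := fun _ => ∑ j ∈ univ.erase i, bregPhi ((F j).erase k).card)]
      · rw [Finset.sum_const, nsmul_eq_mul]
        exact mul_le_mul_of_nonneg_left (key i k) (by positivity)
      · intro σ hσ
        rw [(Finset.mem_filter.mp hσ).2]
    have tot := Finset.sum_le_sum (fun i (_ : i ∈ (univ : Finset α)) => step i)
    rw [Finset.sum_const, Finset.sum_comm, nsmul_eq_mul, Finset.card_univ] at tot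
    have inner : ∀ σ ∈ S, ∑ i, (Real.log (F i).card
        + ∑ j ∈ univ.erase i, bregPhi ((F j).erase (σ i)).card)
        = Fintype.card α * ∑ j, bregPhi (F j).card := by
      intro σ hσ
      rw [Finset.mul_sum, ← Finset.sum_congr rfl (fun j _ => breg_count F σ (hmem σ hσ) j),
        Finset.sum_add_distrib, Finset.sum_add_distrib]
      congr 1
      refine Finset.sum_comm' ?_
      intro x y; simp [ne_comm]
    rw [Finset.sum_congr rfl inner, Finset.sum_const, nsmul_eq_mul] at tot
    have hn : (0 : ℝ) < Fintype.card α := by rw [h]; positivity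
    have : ((Fintype.card α : ℝ) * S.card) * Real.log S.card
        ≤ ((Fintype.card α : ℝ) * S.card) * ∑ j, bregPhi (F j).card := by linarith
    exact le_of_mul_le_mul_left this (mul_pos hn hP)

lemma ball_row_card (n r : ℕ) (hr : 2 * r + 1 ≤ n) (i : Fin n) :
    (Finset.univ.filter fun j : Fin n => (((j : ℕ) : ℤ) - ((i : ℕ) : ℤ)).natAbs ≤ r).card
      = min (i : ℕ) r + min (n - 1 - i) r + 1 := by
  have h : ((Finset.univ.filter fun j : Fin n => (((j : ℕ) : ℤ) - ((i : ℕ) : ℤ)).natAbs ≤ r).map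
      Fin.valEmbedding) = Finset.Icc ((i : ℕ) - r) (min (i + r) (n - 1)) := by
    ext k
    simp only [Finset.mem_map, Finset.mem_filter, Finset.mem_univ, true_and, Finset.mem_Icc,
      Fin.valEmbedding_apply]
    constructor
    · rintro ⟨j, hj, rfl⟩
      have := j.2
      omega
    · intro hk
      have := i.2
      exact ⟨⟨k, by omega⟩, by simp only; omega, rfl⟩
  rw [← Finset.card_map, h, Nat.card_Icc]
  have := i.2
  omega

lemma ball_sum (φ : ℕ → ℝ) (n r : ℕ) (hr : 2 * r + 1 ≤ n) :
    ∑ i : Fin n, φ (min (i : ℕ) r + min (n - 1 - i) r + 1)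
      = ((n : ℝ) - 2 * r) * φ (2 * r + 1) + ∑ i ∈ Finset.Icc (r + 1) (2 * r), 2 * φ i := by
  rw [Fin.sum_univ_eq_sum_range (fun i => φ (min i r + min (n - 1 - i) r + 1)) n]
  obtain ⟨m, rfl⟩ : ∃ m, n = r + m + r := ⟨n - 2 * r, by omega⟩
  rw [Finset.sum_range_add, Finset.sum_range_add]
  have hI : ∑ i ∈ Finset.Icc (r + 1) (2 * r), 2 * φ i = 2 * ∑ i ∈ Finset.range r, φ (r + 1 + i) := by
    rw [← Finset.mul_sum]
    congr 1
    have : Finset.Icc (r + 1) (2 * r) = Finset.Ico (r + 1) (2 * r + 1) := by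
      ext x; simp only [Finset.mem_Icc, Finset.mem_Ico]; omega
    rw [this, Finset.sum_Ico_eq_sum_range]
    congr 2
    omega
  have h1 : ∑ x ∈ Finset.range r, φ (min x r + min (r + m + r - 1 - x) r + 1)
      = ∑ i ∈ Finset.range r, φ (r + 1 + i) := by
    refine Finset.sum_congr rfl fun x hx => ?_
    rw [Finset.mem_range] at hx
    congr 1; omega
  have h2 : ∑ x ∈ Finset.range m, φ (min (r + x) r + min (r + m + r - 1 - (r + x)) r + 1)
      = m * φ (2 * r + 1) := by
    rw [Finset.sum_congr rfl (g := fun _ => φ (2 * r + 1))]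
    · simp
    · intro x hx
      rw [Finset.mem_range] at hx
      congr 1; omega
  have h3 : ∑ x ∈ Finset.range r, φ (min (r + m + x) r + min (r + m + r - 1 - (r + m + x)) r + 1)
      = ∑ i ∈ Finset.range r, φ (r + 1 + i) := by
    rw [← Finset.sum_range_reflect (fun i => φ (r + 1 + i))]
    refine Finset.sum_congr rfl fun x hx => ?_
    rw [Finset.mem_range] at hx
    congr 1; omega
  rw [h1, h2, h3, hI]
  push_cast
  ring

/-- For `0 ≤ r ≤ (n-1)/2` (i.e. `2r + 1 ≤ n`),
`|B_{r,n}| ≤ ((2r+1)!)^((n-2r)/(2r+1)) ⬝ ∏_{i=r+1}^{2r} (i!)^(2/i)`,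
with real exponents. -/
theorem ball_upper_bound_small_radius (n r : ℕ) (hn : 1 ≤ n)
    (hr : 2 * r + 1 ≤ n) :
    (ballCard n r : ℝ) ≤
      ((Nat.factorial (2 * r + 1) : ℝ) ^ (((n : ℝ) - 2 * r) / (2 * r + 1))) *
        ∏ i ∈ Finset.Icc (r + 1) (2 * r),
          (Nat.factorial i : ℝ) ^ ((2 : ℝ) / i) := by
  have hcard : ballCard n r = (bregS fun i : Fin n =>
      Finset.univ.filter fun j : Fin n => (((j : ℕ) : ℤ) - ((i : ℕ) : ℤ)).natAbs ≤ r).card := by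
    unfold ballCard bregS
    classical
    rw [Nat.card_eq_fintype_card, Fintype.card_subtype]
    congr 1
    ext g
    simp [dinf]
  have hb := bregman n (fun i : Fin n =>
      Finset.univ.filter fun j : Fin n => (((j : ℕ) : ℤ) - ((i : ℕ) : ℤ)).natAbs ≤ r)
      (Fintype.card_fin n)
  rw [← hcard] at hb
  simp only [ball_row_card n r hr] at hb
  rw [ball_sum bregPhi n r hr] at hb
  have hpos : ∀ m : ℕ, (0 : ℝ) < (m.factorial : ℝ) := fun m => by exact_mod_cast m.factorial_pos
  have hprod : 0 < ∏ i ∈ Finset.Icc (r + 1) (2 * r), (Nat.factorial i : ℝ) ^ ((2 : ℝ) / i) :=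
    Finset.prod_pos fun i _ => Real.rpow_pos_of_pos (hpos i) _
  have hfst := Real.rpow_pos_of_pos (hpos (2 * r + 1)) (((n : ℝ) - 2 * r) / (2 * r + 1))
  rcases Nat.eq_zero_or_pos (ballCard n r) with h0 | h0
  · rw [h0]
    simpa using (mul_pos hfst hprod).le
  rw [← Real.log_le_log_iff (by exact_mod_cast h0) (mul_pos hfst hprod),
    Real.log_mul hfst.ne' hprod.ne', Real.log_rpow (hpos _),
    Real.log_prod (fun i _ => (Real.rpow_pos_of_pos (hpos i) _).ne')]
  refine hb.trans (le_of_eq ?_)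
  congr 1
  · unfold bregPhi; push_cast; ring
  · refine Finset.sum_congr rfl fun i _ => ?_
    rw [Real.log_rpow (hpos _)]
    unfold bregPhi; ring
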